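/- arXiv:1404.6975 — 6 statements merged into one kernel-verified Lean document; each statement's English description precedes it below -/
import Mathlib

section
/- Let (Ω, 𝔽, ρ) be a probability space, X : Ω → [0,∞) measurable, and α > 0. Then the following are equivalent: (i) there exists δ > 0 such that ∫ 1_{X ≥ 1} · exp(δ (ln X)^{1 + 1/α}) dρ < ∞; (ii) there exist constants E₀ > 0 and C > 1 such that for all real p ≥ 1, ∫ X^p dρ ≤ E₀ · C^{p^{1+α}}. -/
open MeasureTheory Set
open scoped ENNReal

/-- Young-type bound: `p L` is dominated by `δ L ^ (1 + 1/α)` up to a multiple of `p ^ (1 + α)`. -/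
lemma mul_le_rpow_add_rpow {α δ L p : ℝ} (hα : 0 < α) (hδ : 0 < δ) (hL : 0 ≤ L) (hp : 0 < p) :
    p * L ≤ δ * L ^ (1 + 1 / α) + (δ⁻¹) ^ α * p ^ (1 + α) := by
  have h1 : L ^ (1 + 1 / α) = L * L ^ (1 / α) := by
    rw [Real.rpow_add_of_nonneg hL zero_le_one (by positivity), Real.rpow_one]
  have h2 : p ^ (1 + α) = p * p ^ α := by
    rw [Real.rpow_add hp, Real.rpow_one]
  have hnn1 : 0 ≤ δ * L ^ (1 + 1 / α) := by positivity
  have hnn2 : 0 ≤ (δ⁻¹) ^ α * p ^ (1 + α) := by positivity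
  rcases le_total (p / δ) (L ^ (1 / α)) with h | h
  · have h3 : p ≤ δ * L ^ (1 / α) := by
      rw [div_le_iff₀ hδ] at h
      linarith
    have h4 := mul_le_mul_of_nonneg_right h3 hL
    rw [h1] at *
    linarith
  · have h3 : L ≤ (p / δ) ^ α := by
      have h5 := Real.rpow_le_rpow (by positivity) h hα.le
      rwa [← Real.rpow_mul hL, one_div_mul_cancel hα.ne', Real.rpow_one] at h5
    rw [div_eq_inv_mul, Real.mul_rpow (by positivity) hp.le] at h3
    have h4 := mul_le_mul_of_nonneg_left h3 hp.le
    rw [h2] at *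
    linarith

/-- For `L` large, some positive integer `n` makes `n L - k n ^ (1 + α)` dominate
a multiple of `L ^ (1 + 1/α)`. -/
lemma exists_nat_rpow_le {α k L : ℝ} (hα : 0 < α) (hk : 0 < k) (hL : 2 * k ≤ L) :
    ∃ n : ℕ, ((2 * k)⁻¹ ^ (1 / α) / 4) * L ^ (1 + 1 / α) ≤
      (n + 1 : ℝ) * L - k * (n + 1 : ℝ) ^ (1 + α) := by
  have hL0 : 0 < L := by linarith
  set y := ((2 * k)⁻¹ * L) ^ (1 / α) with hy
  have hy1 : 1 ≤ y := by
    apply Real.one_le_rpow _ (by positivity)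
    rw [← div_eq_inv_mul, le_div_iff₀ (by positivity)]
    linarith
  obtain ⟨n, hn⟩ : ∃ n, ⌊y⌋₊ = n + 1 :=
    Nat.exists_eq_succ_of_ne_zero (Nat.floor_pos.2 hy1).ne'
  have hle : (n + 1 : ℝ) ≤ y := by
    have := Nat.floor_le (zero_le_one.trans hy1)
    rw [hn] at this
    exact_mod_cast this
  have hlt : y < (n + 1 : ℝ) + 1 := by
    have := Nat.lt_floor_add_one y
    rw [hn] at this
    exact_mod_cast this
  refine ⟨n, ?_⟩
  have hn0 : (0 : ℝ) ≤ n := n.cast_nonneg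
  generalize (n : ℝ) = m at *
  have hpow : (m + 1) ^ α ≤ (2 * k)⁻¹ * L := by
    have h := Real.rpow_le_rpow (by positivity) hle hα.le
    rwa [hy, ← Real.rpow_mul (by positivity), one_div_mul_cancel hα.ne', Real.rpow_one] at h
  have h2 : (m + 1) ^ (1 + α) = (m + 1) * (m + 1) ^ α := by
    rw [Real.rpow_add (by positivity), Real.rpow_one]
  have h1 : (2 * k)⁻¹ ^ (1 / α) / 4 * L ^ (1 + 1 / α) = y * L / 4 := by
    rw [hy, Real.mul_rpow (by positivity) hL0.le, Real.rpow_add hL0, Real.rpow_one]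
    ring
  have h3 : k * (m + 1) ^ (1 + α) ≤ (m + 1) * L / 2 := by
    calc k * (m + 1) ^ (1 + α) = k * (m + 1) * (m + 1) ^ α := by rw [h2]; ring
      _ ≤ k * (m + 1) * ((2 * k)⁻¹ * L) := by gcongr
      _ = (m + 1) * L / 2 := by field_simp
  have h4 : y * L ≤ 2 * (m + 1) * L := by
    gcongr
    linarith
  rw [h1]
  linarith

/-- Equivalence between integrability of `1_{X ≥ 1} exp(δ (ln X)^{1+1/α})` for some
`δ > 0` and moment bounds `∫ X^p dρ ≤ E₀ C^{p^{1+α}}` for some `E₀ > 0`, `C > 1`. -/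
theorem stmt_4 {Ω : Type*} [MeasurableSpace Ω] (ρ : Measure Ω) [IsProbabilityMeasure ρ]
    (X : Ω → ℝ) (hX : Measurable X) (hXnn : ∀ ω, 0 ≤ X ω) (α : ℝ) (hα : 0 < α) :
    (∃ δ : ℝ, 0 < δ ∧
        ∫⁻ ω, ENNReal.ofReal ((Set.indicator {ω' | 1 ≤ X ω'}
          (fun ω' => Real.exp (δ * Real.log (X ω') ^ (1 + 1 / α)))) ω) ∂ρ < ⊤) ↔
      (∃ E₀ C : ℝ, 0 < E₀ ∧ 1 < C ∧ ∀ p : ℝ, 1 ≤ p →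
        ∫⁻ ω, ENNReal.ofReal (X ω ^ p) ∂ρ ≤ ENNReal.ofReal (E₀ * C ^ (p ^ (1 + α)))) := by
  constructor
  · rintro ⟨δ, hδ, hfin⟩
    set F : Ω → ℝ := Set.indicator {ω' | 1 ≤ X ω'}
      (fun ω' => Real.exp (δ * Real.log (X ω') ^ (1 + 1 / α)))
    have hF0 : ∀ ω, 0 ≤ F ω := fun ω => Set.indicator_nonneg (fun _ _ => (Real.exp_pos _).le) ω
    have hc : 0 < (δ⁻¹) ^ α := by positivity
    set M := ∫⁻ ω, ENNReal.ofReal (F ω) ∂ρ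
    refine ⟨M.toReal + 1, Real.exp ((δ⁻¹) ^ α), by positivity, Real.one_lt_exp_iff.2 hc, ?_⟩
    intro p hp
    have hp0 : 0 < p := by linarith
    rw [← Real.exp_mul]
    set K := Real.exp ((δ⁻¹) ^ α * p ^ (1 + α)) with hK
    have hK1 : 1 ≤ K := Real.one_le_exp (by positivity)
    have hpt : ∀ ω, X ω ^ p ≤ K * (F ω + 1) := by
      intro ω
      by_cases h1 : 1 ≤ X ω
      · have hFω : F ω = Real.exp (δ * Real.log (X ω) ^ (1 + 1 / α)) :=
          Set.indicator_of_mem (s := {ω' | 1 ≤ X ω'}) h1 _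
        calc X ω ^ p = Real.exp (p * Real.log (X ω)) := by
              rw [Real.rpow_def_of_pos (by linarith), mul_comm]
          _ ≤ Real.exp (δ * Real.log (X ω) ^ (1 + 1 / α) + (δ⁻¹) ^ α * p ^ (1 + α)) :=
              Real.exp_le_exp.2 (mul_le_rpow_add_rpow hα hδ (Real.log_nonneg h1) hp0)
          _ = K * F ω := by rw [Real.exp_add, hFω, hK, mul_comm]
          _ ≤ K * (F ω + 1) := by gcongr; linarith
      · calc X ω ^ p ≤ 1 := Real.rpow_le_one (hXnn ω) (not_le.1 h1).le hp0.le
          _ ≤ K * (F ω + 1) := one_le_mul_of_one_le_of_one_le hK1 (by linarith [hF0 ω])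
    calc ∫⁻ ω, ENNReal.ofReal (X ω ^ p) ∂ρ
        ≤ ∫⁻ ω, ENNReal.ofReal K * (ENNReal.ofReal (F ω) + 1) ∂ρ := by
          refine lintegral_mono fun ω => ?_
          rw [← ENNReal.ofReal_one, ← ENNReal.ofReal_add (hF0 ω) zero_le_one,
            ← ENNReal.ofReal_mul (by positivity)]
          exact ENNReal.ofReal_le_ofReal (hpt ω)
      _ = ENNReal.ofReal K * (M + 1) := by
          rw [lintegral_const_mul' _ _ ENNReal.ofReal_ne_top,
            lintegral_add_right _ measurable_const, lintegral_one, measure_univ]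
      _ = ENNReal.ofReal ((M.toReal + 1) * K) := by
          rw [mul_comm, ENNReal.ofReal_mul (by positivity),
            ENNReal.ofReal_add ENNReal.toReal_nonneg zero_le_one, ENNReal.ofReal_toReal hfin.ne,
            ENNReal.ofReal_one]
  · rintro ⟨E₀, C, hE, hC, hmom⟩
    have hc : 0 < Real.log C := Real.log_pos hC
    set k := Real.log C + 1 with hk
    have hk0 : 0 < k := by positivity
    set δ := (2 * k)⁻¹ ^ (1 / α) / 4
    have hδ0 : 0 < δ := by positivity
    refine ⟨δ, hδ0, ?_⟩
    set K := Real.exp (δ * (2 * k) ^ (1 + 1 / α))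
    set a : ℕ → ℝ := fun n => Real.exp (-(k * (n + 1 : ℝ) ^ (1 + α)))
    have hpt : ∀ ω, ENNReal.ofReal ((Set.indicator {ω' | 1 ≤ X ω'}
          (fun ω' => Real.exp (δ * Real.log (X ω') ^ (1 + 1 / α)))) ω) ≤
        ENNReal.ofReal K +
          ∑' n : ℕ, ENNReal.ofReal (a n) * ENNReal.ofReal (X ω ^ (n + 1 : ℝ)) := by
      intro ω
      by_cases h1 : 1 ≤ X ω
      · rw [Set.indicator_of_mem (s := {ω' | 1 ≤ X ω'}) h1]
        have hlog := Real.log_nonneg h1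
        rcases le_total (Real.log (X ω)) (2 * k) with h | h
        · refine le_add_right (ENNReal.ofReal_le_ofReal (Real.exp_le_exp.2 ?_))
          gcongr
        · obtain ⟨n, hn⟩ := exists_nat_rpow_le hα hk0 h
          refine le_add_left (le_trans ?_ (ENNReal.le_tsum n))
          rw [← ENNReal.ofReal_mul (Real.exp_pos _).le]
          refine ENNReal.ofReal_le_ofReal ?_
          rw [Real.rpow_def_of_pos (x := X ω) (by linarith), ← Real.exp_add]
          refine Real.exp_le_exp.2 (hn.trans_eq ?_)
          ring
      · rw [Set.indicator_of_notMem (s := {ω' | 1 ≤ X ω'}) h1]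
        simp
    have hterm : ∀ n : ℕ, ∫⁻ ω, ENNReal.ofReal (a n) * ENNReal.ofReal (X ω ^ (n + 1 : ℝ)) ∂ρ ≤
        ENNReal.ofReal (E₀ * Real.exp (-n)) := by
      intro n
      have hn1 : (1 : ℝ) ≤ n + 1 := by simp
      rw [lintegral_const_mul' _ _ ENNReal.ofReal_ne_top]
      refine (mul_le_mul_right (hmom _ hn1) _).trans ?_
      rw [← ENNReal.ofReal_mul (Real.exp_pos _).le]
      refine ENNReal.ofReal_le_ofReal ?_
      rw [mul_left_comm, Real.rpow_def_of_pos (x := C) (by linarith), ← Real.exp_add]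
      gcongr
      have := Real.self_le_rpow_of_one_le hn1 (by linarith : 1 ≤ 1 + α)
      rw [hk]
      linarith
    calc _ ≤ ∫⁻ ω, (ENNReal.ofReal K +
            ∑' n : ℕ, ENNReal.ofReal (a n) * ENNReal.ofReal (X ω ^ (n + 1 : ℝ))) ∂ρ :=
          lintegral_mono hpt
      _ = ENNReal.ofReal K +
            ∑' n : ℕ, ∫⁻ ω, ENNReal.ofReal (a n) * ENNReal.ofReal (X ω ^ (n + 1 : ℝ)) ∂ρ := by
          rw [lintegral_add_left measurable_const, lintegral_const, measure_univ, mul_one,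
            lintegral_tsum fun n => by fun_prop]
      _ ≤ ENNReal.ofReal K + ∑' n : ℕ, ENNReal.ofReal (E₀ * Real.exp (-n)) := by
          gcongr with n
          exact hterm n
      _ < ⊤ := by
          have hs : Summable fun n : ℕ => E₀ * Real.exp (-n) :=
            Real.summable_exp_neg_nat.mul_left E₀
          exact ENNReal.add_lt_top.2 ⟨ENNReal.ofReal_lt_top, hs.tsum_ofReal_lt_top⟩
end

section
/- Let (Ω, 𝔽, ρ) be a probability space, X : Ω → [0,∞) measurable, α > 0, and suppose there exist E₀ > 0 and C > 1 such that for all real p ≥ 1, ∫ X^p dρ ≤ E₀ · C^{p^{1+α}}. Set β(α) = (1+α)^{−1/α} · α/(1+α). Then for every λ ≥ exp((1+α) ln C) one has ρ(X ≥ λ) ≤ E₀ · exp( − β(α) · (ln λ)^{1 + 1/α} / (ln C)^{1/α} ). -/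
open MeasureTheory Set
open scoped ENNReal

/-- Markov's inequality for the `p`-th power of a nonnegative function. -/
theorem measure_ge_le_of_lintegral_rpow_le {Ω : Type*} [MeasurableSpace Ω] {μ : Measure Ω}
    {X : Ω → ℝ} (hX : Measurable X) {p l B : ℝ} (hp : 0 ≤ p) (hl : 0 < l)
    (h : ∫⁻ ω, ENNReal.ofReal (X ω ^ p) ∂μ ≤ ENNReal.ofReal B) :
    μ {ω | l ≤ X ω} ≤ ENNReal.ofReal (B / l ^ p) := by
  have hlp : 0 < l ^ p := Real.rpow_pos_of_pos hl p
  have hsub : {ω | l ≤ X ω} ⊆ {ω | ENNReal.ofReal (l ^ p) ≤ ENNReal.ofReal (X ω ^ p)} :=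
    fun ω hω => ENNReal.ofReal_le_ofReal (Real.rpow_le_rpow hl.le hω hp)
  rw [ENNReal.ofReal_div_of_pos hlp]
  calc μ {ω | l ≤ X ω}
      ≤ μ {ω | ENNReal.ofReal (l ^ p) ≤ ENNReal.ofReal (X ω ^ p)} := measure_mono hsub
    _ ≤ (∫⁻ ω, ENNReal.ofReal (X ω ^ p) ∂μ) / ENNReal.ofReal (l ^ p) :=
        meas_ge_le_lintegral_div (by fun_prop)
          (ENNReal.ofReal_pos.2 hlp).ne' ENNReal.ofReal_ne_top
    _ ≤ ENNReal.ofReal B / ENNReal.ofReal (l ^ p) := by gcongr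

/-- The value of `p ↦ L p^{1+α} - M p` at its minimiser. -/
theorem mul_rpow_sub_mul_at_minimizer {α L M : ℝ} (hα : 0 < α) (hL : 0 < L) (hM : 0 < M) :
    L * ((M / ((1 + α) * L)) ^ (1 / α)) ^ (1 + α) - M * (M / ((1 + α) * L)) ^ (1 / α) =
      -((1 + α) ^ (-(1 / α)) * (α / (1 + α)) * M ^ (1 + 1 / α) / L ^ (1 / α)) := by
  have h1 : 0 < 1 + α := by linarith
  have hq : 0 < M / ((1 + α) * L) := by positivity
  have hpow : ((M / ((1 + α) * L)) ^ (1 / α)) ^ α = M / ((1 + α) * L) := by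
    rw [← Real.rpow_mul hq.le, one_div_mul_cancel hα.ne', Real.rpow_one]
  rw [Real.rpow_add (Real.rpow_pos_of_pos hq _), Real.rpow_one, hpow,
    Real.div_rpow hM.le (by positivity), Real.mul_rpow h1.le hL.le,
    Real.rpow_neg h1.le, Real.rpow_add hM, Real.rpow_one]
  have := Real.rpow_pos_of_pos h1 (1 / α)
  have := Real.rpow_pos_of_pos hL (1 / α)
  field_simp
  ring

/-- If `∫ X^p dρ ≤ E₀ C^{p^{1+α}}` for all `p ≥ 1`, then for `λ ≥ exp((1+α) ln C)`,
`ρ(X ≥ λ) ≤ E₀ exp(-β(α) (ln λ)^{1+1/α} / (ln C)^{1/α})` where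
`β(α) = (1+α)^{-1/α} · α/(1+α)`. -/
theorem stmt_5 {Ω : Type*} [MeasurableSpace Ω] (ρ : Measure Ω) [IsProbabilityMeasure ρ]
    (X : Ω → ℝ) (hX : Measurable X) (hXnn : ∀ ω, 0 ≤ X ω) (α E₀ C : ℝ)
    (hα : 0 < α) (hE₀ : 0 < E₀) (hC : 1 < C)
    (hmom : ∀ p : ℝ, 1 ≤ p →
      ∫⁻ ω, ENNReal.ofReal (X ω ^ p) ∂ρ ≤ ENNReal.ofReal (E₀ * C ^ (p ^ (1 + α)))) :
    ∀ l : ℝ, Real.exp ((1 + α) * Real.log C) ≤ l →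
      ρ {ω | l ≤ X ω} ≤
        ENNReal.ofReal (E₀ * Real.exp (-((1 + α) ^ (-(1 / α)) * (α / (1 + α)) *
          Real.log l ^ (1 + 1 / α) / Real.log C ^ (1 / α)))) := by
  intro l hl
  have hL : 0 < Real.log C := Real.log_pos hC
  have h1 : 0 < 1 + α := by linarith
  have hl0 : 0 < l := (Real.exp_pos _).trans_le hl
  have hM : (1 + α) * Real.log C ≤ Real.log l := (Real.le_log_iff_exp_le hl0).2 hl
  have hM0 : 0 < Real.log l := (mul_pos h1 hL).trans_le hM
  have hp : 1 ≤ (Real.log l / ((1 + α) * Real.log C)) ^ (1 / α) :=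
    Real.one_le_rpow ((one_le_div (mul_pos h1 hL)).2 hM) (by positivity)
  refine (measure_ge_le_of_lintegral_rpow_le hX (zero_le_one.trans hp) hl0 (hmom _ hp)).trans_eq ?_
  rw [← mul_rpow_sub_mul_at_minimizer hα hL hM0, Real.exp_sub,
    Real.rpow_def_of_pos (zero_lt_one.trans hC), Real.rpow_def_of_pos hl0, mul_div_assoc]
end

section
/- Let (Ω, 𝔽, ρ) be a probability space, X : Ω → [0,∞) measurable, α > 0, and suppose there exist E₀ > 0 and C > 1 such that for all real p ≥ 1, ∫ X^p dρ ≤ E₀ · C^{p^{1+α}}. Then for every δ with 0 < δ < β(α)/(ln C)^{1/α}, where β(α) = (1+α)^{−1/α} · α/(1+α), one has ∫ 1_{X ≥ 1} · exp(δ (ln X)^{1 + 1/α}) dρ < ∞. -/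
open MeasureTheory Set
open scoped ENNReal

open Filter Topology

/-- The maximum of `c ↦ c - L * c ^ (1 + α)` is `(1+α)^{-1/α} (α/(1+α)) / L^{1/α}`; it is attained. -/
lemma exists_sub_mul_rpow_eq {α L : ℝ} (hα : 0 < α) (hL : 0 < L) :
    ∃ c : ℝ, 0 < c ∧
      c - L * c ^ (1 + α) = (1 + α) ^ (-(1 / α)) * (α / (1 + α)) / L ^ (1 / α) := by
  have h1 : 0 < 1 + α := by linarith
  have hc : 0 < ((1 + α) * L) ^ (-(1 / α)) := by positivity
  refine ⟨((1 + α) * L) ^ (-(1 / α)), hc, ?_⟩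
  have hpow : (((1 + α) * L) ^ (-(1 / α))) ^ α = ((1 + α) * L)⁻¹ := by
    rw [← Real.rpow_mul (by positivity), show -(1 / α) * α = -1 by field_simp, Real.rpow_neg_one]
  rw [Real.rpow_add hc, Real.rpow_one, hpow, Real.mul_rpow h1.le hL.le, Real.rpow_neg hL.le]
  have : 0 < L ^ (1 / α) := by positivity
  field_simp
  ring

/-- Restricting the Legendre-type supremum `sup_p (p t - L p^{1+α})` to positive integers `p`
loses nothing to leading order as `t → ∞`. -/
lemma eventually_exists_nat_mul_sub_ge {α L δ c : ℝ} (hα : 0 < α) (hc : 0 < c)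
    (hδ : δ < c - L * c ^ (1 + α)) :
    ∀ᶠ t : ℝ in atTop, ∃ n : ℕ,
      δ * t ^ (1 + 1 / α) ≤ ((n + 1 : ℕ) : ℝ) * t - L * ((n + 1 : ℕ) : ℝ) ^ (1 + α) := by
  have hlim : Tendsto (fun s : ℝ => (⌈c * s⌉₊ : ℝ) / s - L * ((⌈c * s⌉₊ : ℝ) / s) ^ (1 + α)) atTop
      (𝓝 (c - L * c ^ (1 + α))) := by
    have h := tendsto_nat_ceil_mul_div_atTop hc.le
    exact h.sub ((h.rpow_const (Or.inl hc.ne')).const_mul L)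
  have hev := (tendsto_rpow_atTop (one_div_pos.2 hα)).eventually (hlim.eventually (lt_mem_nhds hδ))
  filter_upwards [hev, eventually_gt_atTop 0] with t ht ht0
  set s := t ^ (1 / α) with hs
  have hs0 : 0 < s := by positivity
  have hN : 0 < ⌈c * s⌉₊ := Nat.ceil_pos.2 (by positivity)
  refine ⟨⌈c * s⌉₊ - 1, ?_⟩
  rw [Nat.sub_add_cancel hN]
  set N : ℝ := (⌈c * s⌉₊ : ℝ)
  have hN0 : 0 ≤ N := by positivity
  have hts : t ^ (1 + 1 / α) = t * s := by rw [Real.rpow_add ht0, Real.rpow_one]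
  have hss : s ^ (1 + α) = t * s := by
    rw [Real.rpow_add hs0, Real.rpow_one, hs, ← Real.rpow_mul ht0.le,
      one_div_mul_cancel hα.ne', Real.rpow_one, mul_comm]
  rw [Real.div_rpow hN0 hs0.le, hss] at ht
  rw [hts]
  calc δ * (t * s) ≤ (N / s - L * (N ^ (1 + α) / (t * s))) * (t * s) := by gcongr
    _ = N * t - L * N ^ (1 + α) := by field_simp

/-- Pointwise domination of `exp (δ (log x)^{1+1/α})` by a constant plus a weighted power series. -/
lemma exists_ofReal_exp_rpow_log_le {α L δ c : ℝ} (hα : 0 < α) (hc : 0 < c) (hδ0 : 0 < δ)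
    (hδ : δ < c - L * c ^ (1 + α)) :
    ∃ M : ℝ, ∀ x : ℝ, 1 ≤ x →
      ENNReal.ofReal (Real.exp (δ * Real.log x ^ (1 + 1 / α))) ≤ ENNReal.ofReal M +
        ∑' n : ℕ, ENNReal.ofReal (Real.exp (-(L * ((n + 1 : ℕ) : ℝ) ^ (1 + α)))) *
          ENNReal.ofReal (x ^ ((n + 1 : ℕ) : ℝ)) := by
  obtain ⟨T, hT⟩ := eventually_atTop.1 (eventually_exists_nat_mul_sub_ge hα hc hδ)
  refine ⟨Real.exp (δ * T ^ (1 + 1 / α)), fun x hx => ?_⟩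
  have hlog : 0 ≤ Real.log x := Real.log_nonneg hx
  rcases le_total (Real.log x) T with h | h
  · refine le_add_right (ENNReal.ofReal_le_ofReal ?_)
    gcongr
  · obtain ⟨n, hn⟩ := hT _ h
    refine le_add_left (le_trans ?_ (ENNReal.le_tsum n))
    rw [← ENNReal.ofReal_mul (Real.exp_nonneg _), Real.rpow_def_of_pos (show 0 < x by linarith),
      ← Real.exp_add]
    gcongr
    linarith

/-- If `∫ X^p dρ ≤ E₀ C^{p^{1+α}}` for all `p ≥ 1`, then for every
`0 < δ < β(α)/(ln C)^{1/α}` with `β(α) = (1+α)^{-1/α} α/(1+α)`, the function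
`1_{X ≥ 1} exp(δ (ln X)^{1+1/α})` is `ρ`-integrable. -/
theorem stmt_6 {Ω : Type*} [MeasurableSpace Ω] (ρ : Measure Ω) [IsProbabilityMeasure ρ]
    (X : Ω → ℝ) (hX : Measurable X) (hXnn : ∀ ω, 0 ≤ X ω) (α E₀ C : ℝ)
    (hα : 0 < α) (hE₀ : 0 < E₀) (hC : 1 < C)
    (hmom : ∀ p : ℝ, 1 ≤ p →
      ∫⁻ ω, ENNReal.ofReal (X ω ^ p) ∂ρ ≤ ENNReal.ofReal (E₀ * C ^ (p ^ (1 + α)))) :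
    ∀ δ : ℝ, 0 < δ →
      δ < (1 + α) ^ (-(1 / α)) * (α / (1 + α)) / Real.log C ^ (1 / α) →
      ∫⁻ ω, ENNReal.ofReal ((Set.indicator {ω' | 1 ≤ X ω'}
        (fun ω' => Real.exp (δ * Real.log (X ω') ^ (1 + 1 / α)))) ω) ∂ρ < ⊤ := by
  intro δ hδ0 hδ
  have hL : 0 < Real.log C := Real.log_pos hC
  obtain ⟨c, hc, hceq⟩ := exists_sub_mul_rpow_eq hα hL
  rw [← hceq] at hδ
  obtain ⟨ε, hε, hδε⟩ : ∃ ε : ℝ, 0 < ε ∧ δ < c - (Real.log C + ε) * c ^ (1 + α) := by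
    have hcp : 0 < c ^ (1 + α) := by positivity
    refine ⟨(c - Real.log C * c ^ (1 + α) - δ) / (2 * c ^ (1 + α)),
      div_pos (by linarith) (by positivity), ?_⟩
    rw [add_mul, div_mul_eq_mul_div, mul_div_mul_right _ _ hcp.ne']
    linarith
  obtain ⟨M, hM⟩ := exists_ofReal_exp_rpow_log_le hα hc hδ0 hδε
  set w : ℕ → ℝ≥0∞ := fun n =>
    ENNReal.ofReal (Real.exp (-((Real.log C + ε) * ((n + 1 : ℕ) : ℝ) ^ (1 + α))))
  have hmeas : ∀ n : ℕ, Measurable fun ω => ENNReal.ofReal (X ω ^ ((n + 1 : ℕ) : ℝ)) :=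
    fun n => (hX.pow_const _).ennreal_ofReal
  have hterm : ∀ n : ℕ, w n * ∫⁻ ω, ENNReal.ofReal (X ω ^ ((n + 1 : ℕ) : ℝ)) ∂ρ ≤
      ENNReal.ofReal (E₀ * Real.exp (-ε) ^ (n + 1)) := by
    intro n
    have hn : (1 : ℝ) ≤ ((n + 1 : ℕ) : ℝ) := by simp
    refine (mul_le_mul_right (hmom _ hn) (w n)).trans ?_
    rw [← ENNReal.ofReal_mul (Real.exp_nonneg _)]
    apply ENNReal.ofReal_le_ofReal
    rw [mul_left_comm, Real.rpow_def_of_pos (show 0 < C by linarith), ← Real.exp_add, ← Real.exp_nat_mul]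
    have hle : ((n + 1 : ℕ) : ℝ) ≤ ((n + 1 : ℕ) : ℝ) ^ (1 + α) :=
      Real.self_le_rpow_of_one_le hn (by linarith)
    gcongr
    nlinarith
  have hsum : Summable fun n : ℕ => E₀ * Real.exp (-ε) ^ (n + 1) :=
    ((summable_nat_add_iff 1).2 (summable_geometric_of_lt_one (Real.exp_nonneg _)
      (by simpa using hε))).mul_left E₀
  calc ∫⁻ ω, ENNReal.ofReal ((Set.indicator {ω' | 1 ≤ X ω'}
        (fun ω' => Real.exp (δ * Real.log (X ω') ^ (1 + 1 / α)))) ω) ∂ρ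
      ≤ ∫⁻ ω, (ENNReal.ofReal M +
          ∑' n : ℕ, w n * ENNReal.ofReal (X ω ^ ((n + 1 : ℕ) : ℝ))) ∂ρ := by
        refine lintegral_mono fun ω => ?_
        by_cases h : 1 ≤ X ω
        · simpa [Set.indicator, h, w] using hM _ h
        · simp [Set.indicator, h]
    _ = ENNReal.ofReal M +
          ∑' n : ℕ, w n * ∫⁻ ω, ENNReal.ofReal (X ω ^ ((n + 1 : ℕ) : ℝ)) ∂ρ := by
        rw [lintegral_add_left measurable_const,
          lintegral_tsum fun n => ((hmeas n).const_mul _).aemeasurable]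
        simp_rw [fun n => lintegral_const_mul (μ := ρ) (w n) (hmeas n)]
        simp
    _ ≤ ENNReal.ofReal M + ∑' n : ℕ, ENNReal.ofReal (E₀ * Real.exp (-ε) ^ (n + 1)) :=
        add_le_add le_rfl (ENNReal.tsum_le_tsum hterm)
    _ < ⊤ := ENNReal.add_lt_top.2 ⟨ENNReal.ofReal_lt_top, hsum.tsum_ofReal_lt_top⟩
end

section
/- Let (Ω, 𝔽, ρ) be a probability space, X : Ω → [0,∞) measurable, α > 0, and suppose there exists δ > 0 such that E₁ := ∫ 1_{X ≥ 1} · exp(δ (ln X)^{1 + 1/α}) dρ < ∞. Then there exist constants E₀ > 0 and C > 1 (depending only on δ, α and E₁) such that for all real p ≥ 1, ∫ X^p dρ ≤ E₀ · C^{p^{1+α}}. -/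
open MeasureTheory Set
open scoped ENNReal

/-- A Young-type inequality with explicit constant. -/
theorem mul_le_mul_rpow_add_rpow_div {α δ p L : ℝ} (hα : 0 < α) (hδ : 0 < δ) (hp : 0 < p)
    (hL : 0 ≤ L) :
    p * L ≤ δ * L ^ (1 + 1 / α) + δ⁻¹ ^ α * p ^ (1 + α) := by
  have h₁ : L ^ (1 + 1 / α) = L * L ^ (1 / α) := by
    rw [Real.rpow_add_of_nonneg hL zero_le_one (by positivity), Real.rpow_one]
  have h₂ : p ^ (1 + α) = p * p ^ α := by rw [Real.rpow_add hp, Real.rpow_one]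
  rcases le_total p (δ * L ^ (1 / α)) with h | h
  · have h₃ : 0 ≤ δ⁻¹ ^ α * p ^ (1 + α) := by positivity
    rw [h₁]
    nlinarith [mul_le_mul_of_nonneg_right h hL]
  · have h₃ : L ^ (1 / α) ≤ δ⁻¹ * p := by
      rwa [inv_mul_eq_div, le_div_iff₀ hδ, mul_comm]
    have h₄ : L ≤ δ⁻¹ ^ α * p ^ α := by
      have := Real.rpow_le_rpow (by positivity) h₃ hα.le
      rwa [← Real.rpow_mul hL, one_div_mul_cancel hα.ne', Real.rpow_one,
        Real.mul_rpow (by positivity) hp.le] at this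
    have h₅ : 0 ≤ δ * L ^ (1 + 1 / α) := by positivity
    rw [h₂]
    nlinarith [mul_le_mul_of_nonneg_left h₄ hp.le]

theorem rpow_le_exp_rpow_mul_exp_log_rpow {α δ p x : ℝ} (hα : 0 < α) (hδ : 0 < δ) (hp : 0 < p)
    (hx : 1 ≤ x) :
    x ^ p ≤ Real.exp (δ⁻¹ ^ α) ^ (p ^ (1 + α)) *
      Real.exp (δ * Real.log x ^ (1 + 1 / α)) := by
  rw [Real.rpow_def_of_pos (by positivity), ← Real.exp_mul, ← Real.exp_add, Real.exp_le_exp]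
  linarith [mul_le_mul_rpow_add_rpow_div hα hδ hp (Real.log_nonneg hx)]

/-- If `E₁ := ∫ 1_{X ≥ 1} exp(δ (ln X)^{1+1/α}) dρ < ∞`, then there are `E₀ > 0`
and `C > 1` depending only on `δ`, `α`, `E₁` such that `∫ X^p dρ ≤ E₀ C^{p^{1+α}}`
for all `p ≥ 1`. -/
theorem stmt_7 (α δ E₁ : ℝ) (hα : 0 < α) (hδ : 0 < δ) :
    ∃ E₀ C : ℝ, 0 < E₀ ∧ 1 < C ∧
      ∀ (Ω : Type) (_ : MeasurableSpace Ω) (ρ : Measure Ω) (_ : IsProbabilityMeasure ρ)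
        (X : Ω → ℝ) (_ : Measurable X) (_ : ∀ ω, 0 ≤ X ω)
        (_ : ∫⁻ ω, ENNReal.ofReal ((Set.indicator {ω' | 1 ≤ X ω'}
              (fun ω' => Real.exp (δ * Real.log (X ω') ^ (1 + 1 / α)))) ω) ∂ρ
            = ENNReal.ofReal E₁),
        ∀ p : ℝ, 1 ≤ p →
          ∫⁻ ω, ENNReal.ofReal (X ω ^ p) ∂ρ ≤ ENNReal.ofReal (E₀ * C ^ (p ^ (1 + α))) := by
  have hC : 1 < Real.exp (δ⁻¹ ^ α) := Real.one_lt_exp_iff.2 (by positivity)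
  refine ⟨1 + max E₁ 0, Real.exp (δ⁻¹ ^ α), by positivity, hC, ?_⟩
  intro Ω _ ρ _ X _ hX hE p hp
  have hp₀ : 0 < p := by linarith
  set D := Real.exp (δ⁻¹ ^ α) ^ (p ^ (1 + α))
  have hD₁ : 1 ≤ D := Real.one_le_rpow hC.le (by positivity)
  set Y : Ω → ℝ := Set.indicator {ω' | 1 ≤ X ω'}
    (fun ω' => Real.exp (δ * Real.log (X ω') ^ (1 + 1 / α)))
  have hY₀ : ∀ ω, 0 ≤ Y ω := fun ω => Set.indicator_nonneg (fun _ _ => (Real.exp_pos _).le) ω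
  have hle : ∀ ω, X ω ^ p ≤ D * (1 + Y ω) := by
    intro ω
    by_cases h : 1 ≤ X ω
    · have hYω : Y ω = Real.exp (δ * Real.log (X ω) ^ (1 + 1 / α)) :=
        Set.indicator_of_mem (s := {ω' | 1 ≤ X ω'}) h _
      have := rpow_le_exp_rpow_mul_exp_log_rpow hα hδ hp₀ h
      rw [hYω]
      linarith
    · have := Real.rpow_le_one (hX ω) (not_le.1 h).le hp₀.le
      nlinarith [hY₀ ω]
  calc ∫⁻ ω, ENNReal.ofReal (X ω ^ p) ∂ρ
      ≤ ∫⁻ ω, ENNReal.ofReal D * (1 + ENNReal.ofReal (Y ω)) ∂ρ := by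
        refine lintegral_mono fun ω => (ENNReal.ofReal_le_ofReal (hle ω)).trans_eq ?_
        rw [ENNReal.ofReal_mul (by positivity), ENNReal.ofReal_add zero_le_one (hY₀ ω),
          ENNReal.ofReal_one]
    _ = ENNReal.ofReal D * (1 + ENNReal.ofReal E₁) := by
        rw [lintegral_const_mul' _ _ ENNReal.ofReal_ne_top,
          lintegral_add_left measurable_const, hE, lintegral_const, measure_univ, mul_one]
    _ ≤ ENNReal.ofReal ((1 + max E₁ 0) * D) := by
        rw [mul_comm, ENNReal.ofReal_mul (by positivity),
          ENNReal.ofReal_add zero_le_one (le_max_right _ _), ENNReal.ofReal_one]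
        gcongr
        exact le_max_left _ _
end

section
/- Let α > 0 and δ > 0. Then there exists a constant C > 1 (depending only on α and δ) such that for all real p ≥ 1, ∫₁^∞ p λ^{p−1} exp(−δ (ln λ)^{1 + 1/α}) dλ ≤ C^{p^{1+α}}. -/
open MeasureTheory Set
open scoped ENNReal

lemma two_mul_mul_sub_rpow_le {α δ p t : ℝ} (hα : 0 < α) (hδ : 0 < δ) (hp : 0 < p) (ht : 0 < t) :
    2 * p * t - δ * t ^ (1 + 1 / α) ≤ 2 * (2 / δ) ^ α * p ^ (1 + α) := by
  rw [Real.rpow_add ht, Real.rpow_add hp, Real.rpow_one, Real.rpow_one]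
  rcases le_total (2 * p / δ) (t ^ (1 / α)) with h | h
  · rw [div_le_iff₀ hδ] at h
    have h₁ : 0 ≤ 2 * (2 / δ) ^ α * (p * p ^ α) := by positivity
    nlinarith [mul_le_mul_of_nonneg_left h ht.le]
  · have h₁ : t ≤ (2 / δ) ^ α * p ^ α := by
      have h₂ := Real.rpow_le_rpow (by positivity) h hα.le
      rwa [← Real.rpow_mul ht.le, one_div_mul_cancel hα.ne', Real.rpow_one, mul_div_right_comm,
        Real.mul_rpow (by positivity) hp.le] at h₂
    have h₃ : 0 ≤ δ * (t * t ^ (1 / α)) := by positivity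
    nlinarith [mul_le_mul_of_nonneg_left h₁ hp.le]

lemma lintegral_Ioi_one_rpow_neg_two :
    ∫⁻ l in Ioi (1 : ℝ), ENNReal.ofReal (l ^ (-2 : ℝ)) = 1 := by
  rw [← ofReal_integral_eq_lintegral_ofReal
    (integrableOn_Ioi_rpow_of_lt (by norm_num) one_pos),
    integral_Ioi_rpow_of_lt (by norm_num) one_pos]
  · norm_num
  · filter_upwards [ae_restrict_mem measurableSet_Ioi] with l hl
    exact Real.rpow_nonneg (one_pos.trans hl).le _

lemma mul_rpow_mul_exp_neg_log_rpow_le {α δ p l : ℝ} (hα : 0 < α) (hδ : 0 < δ) (hp : 1 ≤ p)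
    (hl : 1 < l) :
    p * l ^ (p - 1) * Real.exp (-δ * Real.log l ^ (1 + 1 / α)) ≤
      Real.exp (2 * (2 / δ) ^ α + 1) ^ (p ^ (1 + α)) * l ^ (-2 : ℝ) := by
  have hl₀ : 0 < l := one_pos.trans hl
  have ht : 0 < Real.log l := Real.log_pos hl
  have hp₁ : p ≤ p ^ (1 + α) := Real.self_le_rpow_of_one_le hp (by linarith)
  have hp₂ : p ≤ Real.exp p := by linarith [Real.add_one_le_exp p]
  have h := two_mul_mul_sub_rpow_le hα hδ (one_pos.trans_le hp) ht
  rw [Real.rpow_def_of_pos hl₀, Real.rpow_def_of_pos hl₀, ← Real.exp_mul, ← Real.exp_add,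
    mul_assoc, ← Real.exp_add]
  refine (mul_le_mul_of_nonneg_right hp₂ (Real.exp_pos _).le).trans ?_
  rw [← Real.exp_add, Real.exp_le_exp]
  nlinarith [mul_nonneg (sub_nonneg.2 hp) ht.le]

/-- For `α, δ > 0`, there is `C > 1` such that for all `p ≥ 1`,
`∫₁^∞ p λ^{p-1} exp(-δ (ln λ)^{1+1/α}) dλ ≤ C^{p^{1+α}}`. -/
theorem stmt_9 (α δ : ℝ) (hα : 0 < α) (hδ : 0 < δ) :
    ∃ C : ℝ, 1 < C ∧ ∀ p : ℝ, 1 ≤ p →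
      ∫⁻ l in Set.Ioi (1 : ℝ),
          ENNReal.ofReal (p * l ^ (p - 1) * Real.exp (-δ * Real.log l ^ (1 + 1 / α))) ≤
        ENNReal.ofReal (C ^ (p ^ (1 + α))) := by
  refine ⟨Real.exp (2 * (2 / δ) ^ α + 1), Real.one_lt_exp_iff.2 (by positivity), fun p hp => ?_⟩
  calc
    _ ≤ ∫⁻ l in Ioi (1 : ℝ), ENNReal.ofReal (Real.exp (2 * (2 / δ) ^ α + 1) ^ (p ^ (1 + α))) *
          ENNReal.ofReal (l ^ (-2 : ℝ)) := by
      refine setLIntegral_mono' measurableSet_Ioi fun l hl => ?_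
      rw [← ENNReal.ofReal_mul (by positivity)]
      exact ENNReal.ofReal_le_ofReal (mul_rpow_mul_exp_neg_log_rpow_le hα hδ hp hl)
    _ = _ := by
      rw [lintegral_const_mul' _ _ ENNReal.ofReal_ne_top, lintegral_Ioi_one_rpow_neg_two, mul_one]
end

section
/- Let (Ω, 𝔽, ρ) be a probability space, X : Ω → [0,∞) measurable, α > 0, δ > 0, and E₁ ≥ 0 such that for all λ ≥ 1, ρ(X ≥ λ) ≤ E₁ · exp(−δ (ln λ)^{1 + 1/α}). Then there exist constants E₀ > 0 and C > 1 (depending only on δ, α and E₁) such that for all real p ≥ 1, ∫ X^p dρ ≤ E₀ · C^{p^{1+α}}. -/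
open MeasureTheory Set
open scoped ENNReal

/-- A Young-type inequality with explicit constant: `a x ≤ δ x ^ (1 + 1/α) + δ ^ (-α) a ^ (1 + α)`. -/
theorem mul_le_mul_rpow_add_mul_rpow {α δ a x : ℝ} (hα : 0 < α) (hδ : 0 < δ) (ha : 0 < a)
    (hx : 0 ≤ x) : a * x ≤ δ * x ^ (1 + 1 / α) + δ ^ (-α) * a ^ (1 + α) := by
  have hα' : 0 ≤ 1 / α := by positivity
  rcases le_total x ((a / δ) ^ α) with h | h
  · have h1 : a * (a / δ) ^ α = δ ^ (-α) * a ^ (1 + α) := by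
      rw [Real.div_rpow ha.le hδ.le, Real.rpow_add ha, Real.rpow_one, Real.rpow_neg hδ.le]
      ring
    have h2 : a * x ≤ a * (a / δ) ^ α := by gcongr
    have h3 : 0 ≤ δ * x ^ (1 + 1 / α) := by positivity
    linarith
  · have h1 : a / δ ≤ x ^ (1 / α) := by
      have h2 := Real.rpow_le_rpow (by positivity) h hα'
      rwa [← Real.rpow_mul (by positivity), mul_one_div_cancel hα.ne', Real.rpow_one] at h2
    have hx0 : 0 < x := lt_of_lt_of_le (by positivity) h
    rw [div_le_iff₀ hδ] at h1
    have h3 : a * x ≤ x ^ (1 / α) * δ * x := by gcongr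
    have h4 : 0 ≤ δ ^ (-α) * a ^ (1 + α) := by positivity
    rw [Real.rpow_add hx0, Real.rpow_one]
    linarith

theorem mul_add_one_sub_mul_rpow_le {α δ p : ℝ} (hα : 0 < α) (hδ : 0 < δ) (hp : 1 ≤ p) (n : ℕ) :
    p * (n + 1) - δ * (n : ℝ) ^ (1 + 1 / α) ≤
      (1 + δ ^ (-α) * 2 ^ (1 + α)) * p ^ (1 + α) - n := by
  have h := mul_le_mul_rpow_add_mul_rpow hα hδ (a := p + 1) (by linarith) n.cast_nonneg
  have h1 : (p + 1) ^ (1 + α) ≤ 2 ^ (1 + α) * p ^ (1 + α) := by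
    rw [← Real.mul_rpow (by norm_num) (by linarith)]
    exact Real.rpow_le_rpow (by linarith) (by linarith) (by linarith)
  have h2 : δ ^ (-α) * (p + 1) ^ (1 + α) ≤ δ ^ (-α) * (2 ^ (1 + α) * p ^ (1 + α)) := by gcongr
  have h3 : p ≤ p ^ (1 + α) := Real.self_le_rpow_of_one_le hp (by linarith)
  linarith

/-- Dyadic-type decomposition of a `p`-th power along the level sets `{exp n ≤ X}`. -/
theorem ofReal_rpow_le_one_add_tsum_indicator {Ω : Type*} {X : Ω → ℝ} (hX : ∀ ω, 0 ≤ X ω) {p : ℝ}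
    (hp : 0 ≤ p) (ω : Ω) :
    ENNReal.ofReal (X ω ^ p) ≤ 1 + ∑' n : ℕ, {ω | Real.exp n ≤ X ω}.indicator
      (fun _ ↦ ENNReal.ofReal (Real.exp (p * (n + 1)))) ω := by
  rcases le_total (X ω) 1 with h | h
  · refine le_add_right ?_
    rw [ENNReal.ofReal_le_one]
    exact Real.rpow_le_one (hX ω) h hp
  · have h0 : 0 < X ω := by linarith
    set n := ⌊Real.log (X ω)⌋₊ with hn
    have h1 : Real.exp n ≤ X ω :=
      (Real.le_log_iff_exp_le h0).1 (Nat.floor_le (Real.log_nonneg h))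
    have h2 : Real.log (X ω) ≤ n + 1 := (Nat.lt_floor_add_one _).le
    refine le_add_left (le_trans ?_ (ENNReal.le_tsum n))
    rw [indicator_of_mem (show ω ∈ {ω | Real.exp n ≤ X ω} from h1)]
    apply ENNReal.ofReal_le_ofReal
    rw [Real.rpow_def_of_pos h0, mul_comm]
    gcongr

theorem lintegral_rpow_le_one_add_tsum {Ω : Type*} [MeasurableSpace Ω] (ρ : Measure Ω)
    [IsProbabilityMeasure ρ] {X : Ω → ℝ} (hXm : Measurable X) (hX : ∀ ω, 0 ≤ X ω) {p : ℝ}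
    (hp : 0 ≤ p) :
    ∫⁻ ω, ENNReal.ofReal (X ω ^ p) ∂ρ ≤
      1 + ∑' n : ℕ, ENNReal.ofReal (Real.exp (p * (n + 1))) * ρ {ω | Real.exp n ≤ X ω} := by
  have hm (n : ℕ) : MeasurableSet {ω | Real.exp n ≤ X ω} := measurableSet_le measurable_const hXm
  refine (lintegral_mono (ofReal_rpow_le_one_add_tsum_indicator hX hp)).trans_eq ?_
  rw [lintegral_add_left measurable_const,
    lintegral_tsum fun n ↦ (measurable_const.indicator (hm n)).aemeasurable]
  simp only [lintegral_indicator_const (hm _), lintegral_const, measure_univ, mul_one]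

/-- If `ρ(X ≥ λ) ≤ E₁ exp(-δ (ln λ)^{1+1/α})` for all `λ ≥ 1`, then there exist
`E₀ > 0` and `C > 1` depending only on `δ`, `α`, `E₁` such that
`∫ X^p dρ ≤ E₀ C^{p^{1+α}}` for all `p ≥ 1`. -/
theorem stmt_16 (α δ E₁ : ℝ) (hα : 0 < α) (hδ : 0 < δ) (hE₁ : 0 ≤ E₁) :
    ∃ E₀ C : ℝ, 0 < E₀ ∧ 1 < C ∧
      ∀ (Ω : Type) (_ : MeasurableSpace Ω) (ρ : Measure Ω) (_ : IsProbabilityMeasure ρ)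
        (X : Ω → ℝ) (_ : Measurable X) (_ : ∀ ω, 0 ≤ X ω)
        (_ : ∀ l : ℝ, 1 ≤ l → ρ {ω | l ≤ X ω} ≤
          ENNReal.ofReal (E₁ * Real.exp (-δ * Real.log l ^ (1 + 1 / α)))),
        ∀ p : ℝ, 1 ≤ p →
          ∫⁻ ω, ENNReal.ofReal (X ω ^ p) ∂ρ ≤ ENNReal.ofReal (E₀ * C ^ (p ^ (1 + α))) := by
  have hS : Summable fun n : ℕ ↦ Real.exp (-n) := Real.summable_exp_neg_nat
  set S : ℝ := ∑' n : ℕ, Real.exp (-n)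
  have hS0 : 0 ≤ S := tsum_nonneg fun n ↦ (Real.exp_pos _).le
  set c : ℝ := 1 + δ ^ (-α) * 2 ^ (1 + α) with hc
  have hc0 : 0 < c := by positivity
  refine ⟨1 + E₁ * S, Real.exp c, by positivity, Real.one_lt_exp_iff.2 hc0, ?_⟩
  intro Ω _ ρ _ X hXm hX htail p hp
  rw [← Real.exp_mul]
  set A : ℝ := Real.exp (c * p ^ (1 + α)) with hA
  have hA1 : 1 ≤ A := Real.one_le_exp (by positivity)
  have hterm (n : ℕ) : ENNReal.ofReal (Real.exp (p * (n + 1))) * ρ {ω | Real.exp n ≤ X ω} ≤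
      ENNReal.ofReal (E₁ * A * Real.exp (-n)) := by
    have h := htail (Real.exp n) (Real.one_le_exp n.cast_nonneg)
    rw [Real.log_exp] at h
    refine (mul_le_mul_right h _).trans ?_
    rw [← ENNReal.ofReal_mul (Real.exp_pos _).le]
    apply ENNReal.ofReal_le_ofReal
    rw [mul_left_comm, ← Real.exp_add, mul_assoc, hA, ← Real.exp_add]
    refine mul_le_mul_of_nonneg_left (Real.exp_le_exp.2 ?_) hE₁
    linarith [mul_add_one_sub_mul_rpow_le hα hδ hp n]
  calc ∫⁻ ω, ENNReal.ofReal (X ω ^ p) ∂ρ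
      ≤ 1 + ∑' n : ℕ, ENNReal.ofReal (E₁ * A * Real.exp (-n)) :=
        (lintegral_rpow_le_one_add_tsum ρ hXm hX (by linarith)).trans
          (add_le_add_right (ENNReal.tsum_le_tsum hterm) 1)
    _ = ENNReal.ofReal (1 + E₁ * A * S) := by
        rw [← ENNReal.ofReal_tsum_of_nonneg (fun n ↦ by positivity) (hS.mul_left _),
          tsum_mul_left, ENNReal.ofReal_add zero_le_one (by positivity), ENNReal.ofReal_one]
    _ ≤ ENNReal.ofReal ((1 + E₁ * S) * A) := by
        apply ENNReal.ofReal_le_ofReal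
        linarith
end
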